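/- arXiv:1905.08621 — 5 statements merged into one kernel-verified Lean document; each statement's English description precedes it below -/
import Mathlib

section
/- For every natural number n and every sequence of nonnegative real weights w_1, …, w_n, define d_0 = 1/2 and d_i = 1/2 + Σ_{j=1}^{i} w_j for 1 ≤ i ≤ n, and set ŵ_i = ⌊d_i⌋ − ⌊d_{i−1}⌋. Then every ŵ_i is a nonnegative integer, and for all indices 1 ≤ a ≤ z ≤ n one has |Σ_{i=a}^{z} ŵ_i − Σ_{i=a}^{z} w_i| < 1. Consequently, every path-shaped graph with nonnegative real edge weights admits a 1-rounding (a rounding in which the weight of every subpath changes by strictly less than 1). -/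
theorem Finset.sum_Icc_sub_pred {M : Type*} [AddCommGroup M] (f : ℕ → M) {a z : ℕ}
    (haz : a ≤ z) :
    ∑ i ∈ Finset.Icc a z, (f i - f (i - 1)) = f z - f (a - 1) := by
  induction z, haz using Nat.le_induction with
  | base => simp
  | succ z haz ih =>
    rw [Finset.sum_Icc_succ_top (by lia), ih, Nat.add_sub_cancel]
    abel

theorem abs_floor_sub_floor_sub_sub_lt_one {R : Type*} [CommRing R] [LinearOrder R]
    [IsStrictOrderedRing R] [FloorRing R] (x y : R) :
    |((⌊x⌋ : R) - ⌊y⌋) - (x - y)| < 1 := by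
  rw [abs_lt]
  constructor <;>
    linarith [Int.floor_le x, Int.lt_floor_add_one x, Int.floor_le y, Int.lt_floor_add_one y]

/-- For every `n` and every sequence of nonnegative real weights `w 1, …, w n`, defining
`d i = 1/2 + ∑_{j=1}^{i} w j` (so `d 0 = 1/2`) and `wr i = ⌊d i⌋ − ⌊d (i-1)⌋`, every `wr i`
(for `1 ≤ i ≤ n`) is a nonnegative integer, and for all `1 ≤ a ≤ z ≤ n` the total rounded
weight of the subpath `e_a, …, e_z` differs from its true weight by strictly less than `1`.
This shows every path-shaped graph with nonnegative edge weights admits a `1`-rounding. -/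
theorem path_graphs_admit_one_rounding
    (n : ℕ) (w : ℕ → ℝ) (hw : ∀ i, 0 ≤ w i) :
    ∀ d : ℕ → ℝ, (∀ i, d i = 1/2 + ∑ j ∈ Finset.Icc 1 i, w j) →
    ∀ wr : ℕ → ℤ, (∀ i, 1 ≤ i → wr i = ⌊d i⌋ - ⌊d (i-1)⌋) →
      (∀ i, 1 ≤ i → i ≤ n → 0 ≤ wr i) ∧
      (∀ a z, 1 ≤ a → a ≤ z → z ≤ n →
        |(∑ i ∈ Finset.Icc a z, (wr i : ℝ)) - ∑ i ∈ Finset.Icc a z, w i| < 1) := by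
  intro d hd wr hwr
  have hstep : ∀ i, 1 ≤ i → w i = d i - d (i - 1) := by
    intro i hi
    obtain ⟨k, rfl⟩ := Nat.exists_eq_add_of_le' hi
    rw [Nat.add_sub_cancel, hd, hd, Finset.sum_Icc_succ_top (by lia)]
    ring
  refine ⟨fun i hi _ => ?_, fun a z ha haz _ => ?_⟩
  · rw [hwr i hi, sub_nonneg]
    exact Int.floor_mono (sub_nonneg.mp (hstep i hi ▸ hw i))
  · have hwr_sum : ∑ i ∈ Finset.Icc a z, (wr i : ℝ) = (⌊d z⌋ : ℝ) - ⌊d (a - 1)⌋ := by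
      rw [← Finset.sum_Icc_sub_pred (fun i => (⌊d i⌋ : ℝ)) haz]
      refine Finset.sum_congr rfl fun i hi => ?_
      rw [hwr i (ha.trans (Finset.mem_Icc.mp hi).1), Int.cast_sub]
    have hw_sum : ∑ i ∈ Finset.Icc a z, w i = d z - d (a - 1) := by
      rw [← Finset.sum_Icc_sub_pred d haz]
      exact Finset.sum_congr rfl fun i hi => hstep i (ha.trans (Finset.mem_Icc.mp hi).1)
    rw [hwr_sum, hw_sum]
    exact abs_floor_sub_floor_sub_sub_lt_one _ _
end

section
/- Let T be a finite tree with nonnegative real edge weights ω, and fix any vertex r as root. For each vertex u ≠ r let p(u) be its parent and let d_u be the ω-weight of the unique simple path from r to u (with d_r = 0). Define ω̃({p(u),u}) = ⌊d_u⌋ − ⌊d_{p(u)}⌋. Then ω̃ assigns a nonnegative integer to every edge, and for every pair of vertices u, w of T the rounding error on the unique simple path from u to w satisfies |ω̃(π(u,w)) − ω(π(u,w))| < 2. Consequently, every finite tree with nonnegative real edge weights admits a 2-rounding. -/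
open SimpleGraph

/-- The weight of a walk: the sum of the weights of its (directed) edges. -/
noncomputable def wWeight {V : Type*} {G : SimpleGraph V} (w : V → V → ℝ) {u v : V}
    (p : G.Walk u v) : ℝ :=
  (p.darts.map (fun d => w d.toProd.1 d.toProd.2)).sum

namespace SimpleGraph.Walk

variable {V : Type*} {G : SimpleGraph V}

@[simp]
theorem wWeight_nil (w : V → V → ℝ) (u : V) : wWeight w (nil : G.Walk u u) = 0 := by
  simp [wWeight]

@[simp]
theorem wWeight_cons (w : V → V → ℝ) {u v x : V} (h : G.Adj u v) (q : G.Walk v x) :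
    wWeight w (cons h q) = w u v + wWeight w q := by
  simp [wWeight]

theorem wWeight_sub (w₁ w₂ : V → V → ℝ) {u v : V} (q : G.Walk u v) :
    wWeight (fun a b => w₁ a b - w₂ a b) q = wWeight w₁ q - wWeight w₂ q := by
  induction q with
  | nil => simp
  | cons h q ih => rw [wWeight_cons, wWeight_cons, wWeight_cons, ih]; ring

theorem wWeight_congr {w₁ w₂ : V → V → ℝ} (h : ∀ a b, G.Adj a b → w₁ a b = w₂ a b)
    {u v : V} (q : G.Walk u v) : wWeight w₁ q = wWeight w₂ q := by
  induction q with
  | nil => simp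
  | cons hab q ih => rw [wWeight_cons, wWeight_cons, ih, h _ _ hab]

variable {r : V} {p : V → V} {e : V → V → ℝ} {f : V → ℝ}

/-- A path that continues a step from a parent to its child only descends, so the weights
`f (p u) - f u` telescope along it. -/
theorem IsPath.wWeight_eq_sub_of_parent_notMem
    (hedge : ∀ a b, G.Adj a b → (a ≠ r ∧ p a = b) ∨ (b ≠ r ∧ p b = a))
    (he : ∀ u, u ≠ r → e (p u) u = f (p u) - f u)
    {v w : V} {q : G.Walk v w} (hq : q.IsPath) (hv : p v ∉ q.support) :
    wWeight e q = f v - f w := by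
  induction q with
  | nil => simp
  | @cons v x w h q ih =>
    rw [cons_isPath_iff] at hq
    rcases hedge v x h with ⟨-, rfl⟩ | ⟨hx, rfl⟩
    · simp at hv
    · rw [wWeight_cons, ih hq.1 hq.2, he x hx]
      ring

/-- A path ascends to some vertex `c` and then descends. -/
theorem IsPath.exists_wWeight_eq
    (hedge : ∀ a b, G.Adj a b → (a ≠ r ∧ p a = b) ∨ (b ≠ r ∧ p b = a))
    (hsymm : ∀ a b, e a b = e b a)
    (he : ∀ u, u ≠ r → e (p u) u = f (p u) - f u)
    {u w : V} {q : G.Walk u w} (hq : q.IsPath) :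
    ∃ c, wWeight e q = 2 * f c - f u - f w := by
  induction q with
  | @nil u => exact ⟨u, by rw [wWeight_nil]; ring⟩
  | @cons u v w h q ih =>
    rw [cons_isPath_iff] at hq
    rcases hedge u v h with ⟨hu, rfl⟩ | ⟨hv, rfl⟩
    · obtain ⟨c, hc⟩ := ih hq.1
      exact ⟨c, by rw [wWeight_cons, hc, hsymm, he u hu]; ring⟩
    · refine ⟨p v, ?_⟩
      rw [wWeight_cons, hq.1.wWeight_eq_sub_of_parent_notMem hedge he hq.2, he v hv]
      ring

end SimpleGraph.Walk

/-- Let `T` be a finite tree with nonnegative real edge weights `ω`, rooted at `r`, with parent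
function `p` and `d u` the `ω`-weight of the unique simple path from `r` to `u` (so
`d r = 0` and `d u = d (p u) + ω (p u) u` for `u ≠ r`).  Define
`ω̃ {p u, u} = ⌊d u⌋ − ⌊d (p u)⌋`.  Then `ω̃` assigns a nonnegative integer to every edge,
and for every pair of vertices `u, w` the rounding error on the unique simple path from `u`
to `w` has absolute value less than `2`.  Consequently every finite tree with nonnegative
real edge weights admits a `2`-rounding. -/
theorem tree_floor_rounding_error_lt_two {V : Type*} [Fintype V]
    (G : SimpleGraph V) (hG : G.IsTree)
    (ω : V → V → ℝ) (hsym : ∀ a b, ω a b = ω b a) (hnonneg : ∀ a b, 0 ≤ ω a b)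
    (r : V) (p : V → V)
    (hadj : ∀ u, u ≠ r → G.Adj (p u) u)
    (hedge : ∀ a b, G.Adj a b → (a ≠ r ∧ p a = b) ∨ (b ≠ r ∧ p b = a))
    (d : V → ℝ) (hdr : d r = 0)
    (hd : ∀ (u : V) (q : G.Walk r u), q.IsPath → d u = wWeight ω q)
    (hdparent : ∀ u, u ≠ r → d u = d (p u) + ω (p u) u)
    (ω' : V → V → ℤ) (hsym' : ∀ a b, ω' a b = ω' b a)
    (hdef : ∀ u, u ≠ r → ω' (p u) u = ⌊d u⌋ - ⌊d (p u)⌋) :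
    (∀ u, u ≠ r → 0 ≤ ω' (p u) u) ∧
    (∀ (u w : V) (q : G.Walk u w), q.IsPath →
      |wWeight (fun a b => (ω' a b : ℝ)) q - wWeight ω q| < 2) ∧
    (∃ n : V → V → ℕ, (∀ a b, n a b = n b a) ∧
      ∀ (u w : V) (q : G.Walk u w), q.IsPath →
        |wWeight (fun a b => (n a b : ℝ)) q - wWeight ω q| < 2) := by
  have hpos : ∀ u, u ≠ r → 0 ≤ ω' (p u) u := fun u hu => by
    rw [hdef u hu, sub_nonneg]
    exact Int.floor_mono (by linarith [hdparent u hu, hnonneg (p u) u])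
  have herr : ∀ (u w : V) (q : G.Walk u w), q.IsPath →
      |wWeight (fun a b => (ω' a b : ℝ)) q - wWeight ω q| < 2 := fun u w q hq => by
    obtain ⟨c, hc⟩ := hq.exists_wWeight_eq (e := fun a b => (ω' a b : ℝ) - ω a b)
      (f := fun v => Int.fract (d v)) hedge (fun a b => by rw [hsym', hsym])
      (fun v hv => by
        simp only [hdef v hv, Int.fract]
        push_cast
        linarith [hdparent v hv])
    rw [← Walk.wWeight_sub, hc, abs_lt]
    constructor <;>
      linarith [Int.fract_nonneg (d c), Int.fract_lt_one (d c), Int.fract_nonneg (d u),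
        Int.fract_lt_one (d u), Int.fract_nonneg (d w), Int.fract_lt_one (d w)]
  refine ⟨hpos, herr, fun a b => (ω' a b).toNat, fun a b => congrArg Int.toNat (hsym' a b),
    fun u w q hq => ?_⟩
  have hcast : ∀ a b, G.Adj a b → ((ω' a b).toNat : ℝ) = (ω' a b : ℝ) := fun a b hab => by
    have hab' : 0 ≤ ω' a b := by
      rcases hedge a b hab with ⟨ha, rfl⟩ | ⟨hb, rfl⟩
      · rw [hsym']
        exact hpos a ha
      · exact hpos b hb
    exact_mod_cast Int.toNat_of_nonneg hab'
  rw [Walk.wWeight_congr hcast]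
  exact herr u w q hq
end

section
/- Consider the 6-vertex graph with vertices v_0, L, R, B, v_2 and edges {v_0,L}, {L,R}, {L,B}, {R,B}, {R,v_2}, all of weight 2.5 (a triangle L,R,B with a pendant edge at L and a pendant edge at R). This graph admits exactly two 1-roundings: either all three triangle edges {L,R}, {L,B}, {R,B} receive rounded weight 3 and the two pendant edges {v_0,L}, {R,v_2} receive rounded weight 2, or all three triangle edges receive 2 and the two pendant edges receive 3. Both of these 1-roundings are strong 1-roundings. -/
open SimpleGraph

def IsShortestPath {V : Type*} {G : SimpleGraph V} (w : V → V → ℝ) {u v : V}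
    (p : G.Walk u v) : Prop :=
  p.IsPath ∧ ∀ q : G.Walk u v, wWeight w p ≤ wWeight w q

def PathObliviousRounding {V : Type*} (G : SimpleGraph V) (w : V → V → ℝ) (wt : V → V → ℕ)
    (ε : ℝ) : Prop :=
  ∀ (u v : V) (p : G.Walk u v), IsShortestPath w p →
    |wWeight (fun a b => (wt a b : ℝ)) p - wWeight w p| < ε

def WeakRounding {V : Type*} (G : SimpleGraph V) (w : V → V → ℝ) (wt : V → V → ℕ)
    (ε : ℝ) : Prop :=
  PathObliviousRounding G w wt ε ∧
  ∀ (u v : V) (p : G.Walk u v), IsShortestPath w p →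
    IsShortestPath (fun a b => (wt a b : ℝ)) p

def StrongRounding {V : Type*} (G : SimpleGraph V) (w : V → V → ℝ) (wt : V → V → ℕ)
    (ε : ℝ) : Prop :=
  WeakRounding G w wt ε ∧
  ∀ (u v : V) (p : G.Walk u v), IsShortestPath (fun a b => (wt a b : ℝ)) p →
    IsShortestPath w p

/-- The minimal variable gadget: vertices `0 = v₀`, `1 = L`, `2 = R`, `3 = B`, `4 = v₂`;
edges `{v₀,L}, {L,R}, {L,B}, {R,B}, {R,v₂}` (triangle `L,R,B` with a pendant edge at `L`
and a pendant edge at `R`). -/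
def gadgetRel (a b : Fin 5) : Prop :=
  (a = 0 ∧ b = 1) ∨ (a = 1 ∧ b = 2) ∨ (a = 1 ∧ b = 3) ∨ (a = 2 ∧ b = 3) ∨ (a = 2 ∧ b = 4)

def gadgetGraph : SimpleGraph (Fin 5) := SimpleGraph.fromRel gadgetRel

/-- All edges have weight `2.5`. -/
noncomputable def gadgetW : Fin 5 → Fin 5 → ℝ := fun _ _ => 2.5

/-- Rounding in which the triangle edges get value `t` and the pendant edges get value `s`. -/
def gadgetAssign (wt : Fin 5 → Fin 5 → ℕ) (t s : ℕ) : Prop :=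
  wt 1 2 = t ∧ wt 1 3 = t ∧ wt 2 3 = t ∧ wt 0 1 = s ∧ wt 2 4 = s

/-- The triangle vertex to which a vertex of the gadget is attached. -/
def gadgetHub : Fin 5 → Fin 5 := ![1, 1, 2, 3, 2]

/-- The least number of triangle edges on a walk between two vertices. -/
def triangleDist (a b : Fin 5) : ℕ := if gadgetHub a = gadgetHub b then 0 else 1

/-- The least number of pendant edges on a walk between two vertices. -/
def pendantDist (a b : Fin 5) : ℕ :=
  if a = b then 0 else (if gadgetHub a = a then 0 else 1) + (if gadgetHub b = b then 0 else 1)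

instance : DecidableRel gadgetRel := fun a b => by unfold gadgetRel; infer_instance

instance : DecidableRel gadgetGraph.Adj := fun a b => by unfold gadgetGraph; infer_instance

section Walk

variable {V : Type*} {G : SimpleGraph V}

@[simp] lemma wWeight_nil (w : V → V → ℝ) (u : V) : wWeight w (Walk.nil : G.Walk u u) = 0 := by
  simp [wWeight]

@[simp] lemma wWeight_cons (w : V → V → ℝ) {u a v : V} (h : G.Adj u a) (p : G.Walk a v) :
    wWeight w (Walk.cons h p) = w u a + wWeight w p := by
  simp [wWeight]

lemma le_wWeight (d : V → V → ℕ) (h₀ : ∀ u, d u u = 0) (h : ∀ u a v, d u v ≤ d u a + d a v)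
    {u v : V} (p : G.Walk u v) : (d u v : ℝ) ≤ wWeight (fun a b => (d a b : ℝ)) p := by
  induction p with
  | nil => simp [h₀]
  | @cons u a v _ p ih =>
    have : (d u v : ℝ) ≤ d u a + d a v := by exact_mod_cast h u a v
    rw [wWeight_cons]
    linarith

lemma wWeight_eq_combination {w w₁ w₂ : V → V → ℝ} {t s : ℝ}
    (hw : ∀ a b, G.Adj a b → w a b = t * w₁ a b + s * w₂ a b) {u v : V} (p : G.Walk u v) :
    wWeight w p = t * wWeight w₁ p + s * wWeight w₂ p := by
  induction p with
  | nil => simp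
  | cons h p ih =>
    rw [wWeight_cons, wWeight_cons, wWeight_cons, ih, hw _ _ h]
    ring

end Walk

lemma triangleDist_le_wWeight {u v : Fin 5} (p : gadgetGraph.Walk u v) :
    (triangleDist u v : ℝ) ≤ wWeight (fun a b => (triangleDist a b : ℝ)) p :=
  le_wWeight _ (by decide) (by decide) p

lemma pendantDist_le_wWeight {u v : Fin 5} (p : gadgetGraph.Walk u v) :
    (pendantDist u v : ℝ) ≤ wWeight (fun a b => (pendantDist a b : ℝ)) p :=
  le_wWeight _ (by decide) (by decide) p

lemma exists_walk_wWeight_eq_dist (u v : Fin 5) : ∃ p : gadgetGraph.Walk u v,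
    wWeight (fun a b => (triangleDist a b : ℝ)) p = triangleDist u v ∧
    wWeight (fun a b => (pendantDist a b : ℝ)) p = pendantDist u v := by
  induction hn : triangleDist u v + pendantDist u v using Nat.strong_induction_on generalizing u with
  | _ n ih =>
    by_cases huv : u = v
    · subst huv
      exact ⟨Walk.nil, by simp [triangleDist, pendantDist]⟩
    · have key : ∀ u v : Fin 5, u ≠ v → ∃ a, gadgetGraph.Adj u a ∧
          triangleDist a v + pendantDist a v < triangleDist u v + pendantDist u v ∧
          triangleDist u a + triangleDist a v = triangleDist u v ∧
          pendantDist u a + pendantDist a v = pendantDist u v := by decide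
      obtain ⟨a, ha, hlt, hτ, hπ⟩ := key u v huv
      obtain ⟨p, hp₁, hp₂⟩ := ih _ (hn ▸ hlt) a rfl
      refine ⟨Walk.cons ha p, ?_, ?_⟩
      · rw [wWeight_cons, hp₁]
        exact_mod_cast hτ
      · rw [wWeight_cons, hp₂]
        exact_mod_cast hπ

/-- `w` gives the triangle edges the value `t` and the pendant edges the value `s`. -/
def HasGadgetWeights (w : Fin 5 → Fin 5 → ℝ) (t s : ℝ) : Prop :=
  ∀ a b, gadgetGraph.Adj a b → w a b = t * triangleDist a b + s * pendantDist a b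

lemma isShortestPath_gadget_iff {w : Fin 5 → Fin 5 → ℝ} {t s : ℝ} (hw : HasGadgetWeights w t s)
    (ht : 0 < t) (hs : 0 < s) {u v : Fin 5} (p : gadgetGraph.Walk u v) :
    IsShortestPath w p ↔ p.IsPath ∧
      wWeight (fun a b => (triangleDist a b : ℝ)) p = triangleDist u v ∧
      wWeight (fun a b => (pendantDist a b : ℝ)) p = pendantDist u v := by
  refine and_congr_right fun _ => ⟨fun h => ?_, fun ⟨h₁, h₂⟩ q => ?_⟩
  · obtain ⟨q, hq₁, hq₂⟩ := exists_walk_wWeight_eq_dist u v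
    have hpq := h q
    rw [wWeight_eq_combination hw, wWeight_eq_combination hw, hq₁, hq₂] at hpq
    have hτ := triangleDist_le_wWeight p
    have hπ := pendantDist_le_wWeight p
    have hτ' := mul_le_mul_of_nonneg_left hτ ht.le
    have hπ' := mul_le_mul_of_nonneg_left hπ hs.le
    exact ⟨(le_of_mul_le_mul_left (by linarith) ht).antisymm hτ,
      (le_of_mul_le_mul_left (by linarith) hs).antisymm hπ⟩
  · rw [wWeight_eq_combination hw, wWeight_eq_combination hw, h₁, h₂]
    exact add_le_add (mul_le_mul_of_nonneg_left (triangleDist_le_wWeight q) ht.le)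
      (mul_le_mul_of_nonneg_left (pendantDist_le_wWeight q) hs.le)

lemma dist_of_adj : ∀ a b, gadgetGraph.Adj a b → triangleDist a b + pendantDist a b = 1 := by
  decide

lemma hasGadgetWeights_gadgetW : HasGadgetWeights gadgetW 2.5 2.5 := fun a b h => by
  have : (triangleDist a b : ℝ) + pendantDist a b = 1 := by exact_mod_cast dist_of_adj a b h
  rw [← mul_add, this, mul_one, gadgetW]

lemma hasGadgetWeights_of_gadgetAssign {wt : Fin 5 → Fin 5 → ℕ} (hsymm : ∀ a b, wt a b = wt b a)
    {t s : ℕ} (h : gadgetAssign wt t s) : HasGadgetWeights (fun a b => (wt a b : ℝ)) t s := by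
  obtain ⟨h₁₂, h₁₃, h₂₃, h₀₁, h₂₄⟩ := h
  have key : ∀ a b, gadgetRel a b → wt a b = t * triangleDist a b + s * pendantDist a b := by
    rintro a b (⟨rfl, rfl⟩ | ⟨rfl, rfl⟩ | ⟨rfl, rfl⟩ | ⟨rfl, rfl⟩ | ⟨rfl, rfl⟩) <;>
      simp [triangleDist, pendantDist, gadgetHub, *]
  have comm : ∀ a b, triangleDist a b = triangleDist b a ∧ pendantDist a b = pendantDist b a := by
    decide
  rintro a b ⟨-, hab | hba⟩ <;> dsimp only
  · exact_mod_cast key a b hab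
  · rw [hsymm, (comm a b).1, (comm a b).2]
    exact_mod_cast key b a hba

lemma strongRounding_of_hasGadgetWeights {wt : Fin 5 → Fin 5 → ℕ} {t s : ℝ}
    (hw : HasGadgetWeights (fun a b => (wt a b : ℝ)) t s)
    (hts : t = 3 ∧ s = 2 ∨ t = 2 ∧ s = 3) : StrongRounding gadgetGraph gadgetW wt 1 := by
  have ht : 0 < t := by rcases hts with ⟨rfl, -⟩ | ⟨rfl, -⟩ <;> norm_num
  have hs : 0 < s := by rcases hts with ⟨-, rfl⟩ | ⟨-, rfl⟩ <;> norm_num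
  have hiff {u v : Fin 5} (p : gadgetGraph.Walk u v) :
      IsShortestPath gadgetW p ↔ IsShortestPath (fun a b => (wt a b : ℝ)) p := by
    rw [isShortestPath_gadget_iff hw ht hs,
      isShortestPath_gadget_iff hasGadgetWeights_gadgetW (by norm_num) (by norm_num)]
  refine ⟨⟨fun u v p hp => ?_, fun _ _ p => (hiff p).1⟩, fun _ _ p => (hiff p).2⟩
  rw [isShortestPath_gadget_iff hasGadgetWeights_gadgetW (by norm_num) (by norm_num)] at hp
  rw [wWeight_eq_combination hw, wWeight_eq_combination hasGadgetWeights_gadgetW, hp.2.1, hp.2.2]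
  have hdist : ∀ u v, triangleDist u v ≤ pendantDist u v + 1 ∧
      pendantDist u v ≤ triangleDist u v + 1 := by decide
  have h₁ : (triangleDist u v : ℝ) ≤ pendantDist u v + 1 := by exact_mod_cast (hdist u v).1
  have h₂ : (pendantDist u v : ℝ) ≤ triangleDist u v + 1 := by exact_mod_cast (hdist u v).2
  rw [abs_lt]
  rcases hts with ⟨rfl, rfl⟩ | ⟨rfl, rfl⟩ <;> constructor <;> linarith

lemma PathObliviousRounding.edge_eq_two_or_three {wt : Fin 5 → Fin 5 → ℕ}
    (h : PathObliviousRounding gadgetGraph gadgetW wt 1) {a b : Fin 5}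
    (hab : gadgetGraph.Adj a b) : wt a b = 2 ∨ wt a b = 3 := by
  have hp := h _ _ (Walk.cons hab Walk.nil) <| by
    rw [isShortestPath_gadget_iff hasGadgetWeights_gadgetW (by norm_num) (by norm_num)]
    simp [hab.ne]
  simp only [wWeight_cons, wWeight_nil, gadgetW, abs_lt] at hp
  have h₁ : 1 < wt a b := by
    have : (1 : ℝ) < wt a b := by linarith
    exact_mod_cast this
  have h₂ : wt a b < 4 := by
    have : (wt a b : ℝ) < 4 := by linarith
    exact_mod_cast this
  omega

lemma PathObliviousRounding.add_eq_five {wt : Fin 5 → Fin 5 → ℕ}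
    (h : PathObliviousRounding gadgetGraph gadgetW wt 1) {a b c : Fin 5}
    (hab : gadgetGraph.Adj a b) (hbc : gadgetGraph.Adj b c) (hac : a ≠ c)
    (hnac : ¬ gadgetGraph.Adj a c) : wt a b + wt b c = 5 := by
  have hdist : ∀ a b c, gadgetGraph.Adj a b → gadgetGraph.Adj b c → a ≠ c →
      ¬ gadgetGraph.Adj a c → triangleDist a b + triangleDist b c = triangleDist a c ∧
      pendantDist a b + pendantDist b c = pendantDist a c := by decide
  obtain ⟨hτ, hπ⟩ := hdist a b c hab hbc hac hnac
  have hp := h _ _ (Walk.cons hab (Walk.cons hbc Walk.nil)) <| by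
    rw [isShortestPath_gadget_iff hasGadgetWeights_gadgetW (by norm_num) (by norm_num)]
    refine ⟨by simp [hab.ne, hbc.ne, hac], ?_, ?_⟩ <;>
      simp only [wWeight_cons, wWeight_nil, add_zero]
    · exact_mod_cast hτ
    · exact_mod_cast hπ
  simp only [wWeight_cons, wWeight_nil, gadgetW, abs_lt] at hp
  have h₁ : 4 < wt a b + wt b c := by
    have : (4 : ℝ) < wt a b + wt b c := by linarith
    exact_mod_cast this
  have h₂ : wt a b + wt b c < 6 := by
    have : (wt a b + wt b c : ℝ) < 6 := by linarith
    exact_mod_cast this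
  omega

lemma PathObliviousRounding.gadgetAssign_or {wt : Fin 5 → Fin 5 → ℕ}
    (hsymm : ∀ a b, wt a b = wt b a) (h : PathObliviousRounding gadgetGraph gadgetW wt 1) :
    gadgetAssign wt 3 2 ∨ gadgetAssign wt 2 3 := by
  have h₀₁ := h.edge_eq_two_or_three (a := 0) (b := 1) (by decide)
  have h₀₁₂ := h.add_eq_five (a := 0) (b := 1) (c := 2) (by decide) (by decide) (by decide)
    (by decide)
  have h₀₁₃ := h.add_eq_five (a := 0) (b := 1) (c := 3) (by decide) (by decide) (by decide)
    (by decide)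
  have h₁₂₄ := h.add_eq_five (a := 1) (b := 2) (c := 4) (by decide) (by decide) (by decide)
    (by decide)
  have h₃₂₄ := h.add_eq_five (a := 3) (b := 2) (c := 4) (by decide) (by decide) (by decide)
    (by decide)
  rw [hsymm 3 2] at h₃₂₄
  unfold gadgetAssign
  omega

/-- The minimal variable gadget (triangle `L,R,B` with pendant edges at `L` and at `R`, all five
edges of weight `2.5`) admits exactly two `1`-roundings: either all three triangle edges get
rounded weight `3` and the two pendant edges get `2`, or vice versa; and both of these
`1`-roundings are strong `1`-roundings. -/
theorem minimal_variable_gadget_two_roundings :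
    (∀ wt : Fin 5 → Fin 5 → ℕ, (∀ a b, wt a b = wt b a) →
      (PathObliviousRounding gadgetGraph gadgetW wt 1 ↔
        (gadgetAssign wt 3 2 ∨ gadgetAssign wt 2 3))) ∧
    (∀ wt : Fin 5 → Fin 5 → ℕ, (∀ a b, wt a b = wt b a) →
      (gadgetAssign wt 3 2 ∨ gadgetAssign wt 2 3) →
      StrongRounding gadgetGraph gadgetW wt 1) := by
  have hstrong (wt : Fin 5 → Fin 5 → ℕ) (hsymm : ∀ a b, wt a b = wt b a)
      (h : gadgetAssign wt 3 2 ∨ gadgetAssign wt 2 3) :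
      StrongRounding gadgetGraph gadgetW wt 1 := by
    rcases h with h | h <;>
      exact strongRounding_of_hasGadgetWeights (hasGadgetWeights_of_gadgetAssign hsymm h)
        (by norm_num)
  exact ⟨fun wt hsymm => ⟨fun h => h.gadgetAssign_or hsymm, fun h => (hstrong wt hsymm h).1.1⟩,
    hstrong⟩
end

section
/- Let T be a finite tree with n vertices, a chosen root r, nonnegative real edge weights ω, and let 0 < ε < 2. Then the error range set 𝓔(T), i.e., the set of root error ranges E(T, ω̃) over all locally optimal ε-roundings ω̃ of T, has at most 2n elements. -/
open SimpleGraph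

/-- An `ε`-rounding of a tree: natural-number edge weights such that the weight of the
(unique) simple path between any two vertices changes by strictly less than `ε`. -/
def TreeRounding {V : Type*} (G : SimpleGraph V) (ω : V → V → ℝ) (wt : V → V → ℕ)
    (ε : ℝ) : Prop :=
  (∀ a b, wt a b = wt b a) ∧
  ∀ (u v : V) (p : G.Walk u v), p.IsPath →
    |wWeight (fun a b => (wt a b : ℝ)) p - wWeight ω p| < ε

/-- The set of rounding errors `e(r,v) = ω̃(π(r,v)) − ω(π(r,v))` over all vertices `v`. -/
def rootErrSet {V : Type*} (G : SimpleGraph V) (ω : V → V → ℝ) (r : V)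
    (wt : V → V → ℕ) : Set ℝ :=
  {x | ∃ (v : V) (p : G.Walk r v), p.IsPath ∧
    x = wWeight (fun a b => (wt a b : ℝ)) p - wWeight ω p}

/-- The root error range `E(T, ω̃)`: the pair of the minimum and maximum rounding error
over all paths from the root (representing the smallest closed interval containing all
rounding errors `e(r,v)`). -/
noncomputable def rootErrRange {V : Type*} (G : SimpleGraph V) (ω : V → V → ℝ) (r : V)
    (wt : V → V → ℕ) : ℝ × ℝ :=
  (sInf (rootErrSet G ω r wt), sSup (rootErrSet G ω r wt))

/-- A rounding is locally optimal if no `ε`-rounding has a root error range contained in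
and strictly smaller than its own. -/
def LocallyOptimal {V : Type*} (G : SimpleGraph V) (ω : V → V → ℝ) (r : V)
    (wt : V → V → ℕ) (ε : ℝ) : Prop :=
  ¬ ∃ wt' : V → V → ℕ, TreeRounding G ω wt' ε ∧
    (rootErrRange G ω r wt).1 ≤ (rootErrRange G ω r wt').1 ∧
    (rootErrRange G ω r wt').2 ≤ (rootErrRange G ω r wt).2 ∧
    rootErrRange G ω r wt' ≠ rootErrRange G ω r wt

/-- The error range set `𝓔(T)`: the set of root error ranges realized by locally optimal
`ε`-roundings. -/
noncomputable def errorRangeSet {V : Type*} (G : SimpleGraph V) (ω : V → V → ℝ) (r : V)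
    (ε : ℝ) : Set (ℝ × ℝ) :=
  {E | ∃ wt : V → V → ℕ, TreeRounding G ω wt ε ∧ LocallyOptimal G ω r wt ε ∧
    E = rootErrRange G ω r wt}

/-- The weight of a walk under natural-number edge weights is a natural number. -/
theorem exists_wWeight_natCast_eq {V : Type*} {G : SimpleGraph V} (wt : V → V → ℕ) {u v : V}
    (p : G.Walk u v) : ∃ n : ℕ, wWeight (fun a b => (wt a b : ℝ)) p = n := by
  refine ⟨(p.darts.map (fun d => wt d.toProd.1 d.toProd.2)).sum, ?_⟩
  rw [wWeight, Nat.cast_list_sum, List.map_map]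
  rfl

theorem zero_mem_rootErrSet {V : Type*} (G : SimpleGraph V) (ω : V → V → ℝ) (r : V)
    (wt : V → V → ℕ) : (0 : ℝ) ∈ rootErrSet G ω r wt :=
  ⟨r, Walk.nil, Walk.IsPath.nil, by simp [wWeight]⟩

theorem finite_rootErrSet {V : Type*} [Finite V] {G : SimpleGraph V} (hG : G.IsAcyclic)
    (ω : V → V → ℝ) (r : V) (wt : V → V → ℕ) : (rootErrSet G ω r wt).Finite := by
  have h : rootErrSet G ω r wt ⊆ ⋃ v : V, {x | ∃ p : G.Walk r v, p.IsPath ∧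
      x = wWeight (fun a b => (wt a b : ℝ)) p - wWeight ω p} := by
    rintro x ⟨v, p, hp, hx⟩
    exact Set.mem_iUnion.2 ⟨v, p, hp, hx⟩
  refine (Set.finite_iUnion fun v => Set.Subsingleton.finite ?_).subset h
  rintro _ ⟨p, hp, rfl⟩ _ ⟨q, hq, rfl⟩
  have hpq : p = q := congrArg Subtype.val ((hG.subsingleton_path r v).elim ⟨p, hp⟩ ⟨q, hq⟩)
  rw [hpq]

/-- A nonpositive real greater than `-2` that differs from `-w` by an integer is one of the two
numbers `-fract w` and `-fract w - 1`. -/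
theorem eq_neg_fract_or_eq_neg_fract_sub_one {w x : ℝ} {n : ℤ} (hx : x = n - w) (h0 : x ≤ 0)
    (h2 : -2 < x) : x = -Int.fract w ∨ x = -Int.fract w - 1 := by
  have hw := Int.floor_add_fract w
  have hf0 := Int.fract_nonneg w
  have hf1 := Int.fract_lt_one w
  have hk1 : ((n - ⌊w⌋ : ℤ) : ℝ) < (1 : ℤ) := by push_cast; linarith
  have hk2 : ((-2 : ℤ) : ℝ) < (n - ⌊w⌋ : ℤ) := by push_cast; linarith
  rw [Int.cast_lt] at hk1 hk2
  obtain hk | hk : n = ⌊w⌋ ∨ n = ⌊w⌋ - 1 := by omega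
  · left; rw [hx, hk]; linarith
  · right; rw [hx, hk]; push_cast; linarith

/-- Root error ranges of locally optimal roundings are determined by their left endpoints. -/
theorem injOn_fst_errorRangeSet {V : Type*} (G : SimpleGraph V) (ω : V → V → ℝ) (r : V)
    (ε : ℝ) : Set.InjOn Prod.fst (errorRangeSet G ω r ε) := by
  rintro _ ⟨wt, hwt, hopt, rfl⟩ _ ⟨wt', hwt', hopt', rfl⟩ h
  by_contra hne
  rcases le_total (rootErrRange G ω r wt).2 (rootErrRange G ω r wt').2 with hle | hle
  · exact hopt' ⟨wt, hwt, h.ge, hle, hne⟩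
  · exact hopt ⟨wt', hwt', h.le, hle, Ne.symm hne⟩

/-- The left endpoint of the root error range of a rounding takes, for each vertex attaining it,
at most two values. -/
theorem exists_fst_eq_of_mem_errorRangeSet {V : Type*} [Finite V] {G : SimpleGraph V}
    (hG : G.IsAcyclic) {ω : V → V → ℝ} {r : V} {ε : ℝ} (hε2 : ε < 2) {E : ℝ × ℝ}
    (hE : E ∈ errorRangeSet G ω r ε) : ∃ (v : V) (p : G.Walk r v), p.IsPath ∧
      (E.1 = -Int.fract (wWeight ω p) ∨ E.1 = -Int.fract (wWeight ω p) - 1) := by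
  obtain ⟨wt, hwt, -, rfl⟩ := hE
  have hfin := finite_rootErrSet hG ω r wt
  have h0 := zero_mem_rootErrSet G ω r wt
  have hle : sInf (rootErrSet G ω r wt) ≤ 0 := csInf_le hfin.bddBelow h0
  obtain ⟨v, p, hp, hx⟩ := Set.Nonempty.csInf_mem ⟨0, h0⟩ hfin
  obtain ⟨n, hn⟩ := exists_wWeight_natCast_eq wt p
  have hlt := (abs_lt.1 (hwt.2 r v p hp)).1
  rw [← hx] at hlt
  refine ⟨v, p, hp, eq_neg_fract_or_eq_neg_fract_sub_one (n := n) ?_ hle ?_⟩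
  · rw [hn] at hx
    exact_mod_cast hx
  · change -2 < sInf (rootErrSet G ω r wt)
    linarith

/-- For a finite tree with `n` vertices, nonnegative real edge weights, a chosen root and
`0 < ε < 2`, the error range set `𝓔(T)` has at most `2n` elements. -/
theorem errorRangeSet_card_le {V : Type*} [Fintype V] (G : SimpleGraph V) (hG : G.IsTree)
    (ω : V → V → ℝ) (hsym : ∀ a b, ω a b = ω b a) (hnonneg : ∀ a b, 0 ≤ ω a b)
    (r : V) (ε : ℝ) (hε0 : 0 < ε) (hε2 : ε < 2) :
    (errorRangeSet G ω r ε).Finite ∧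
    (errorRangeSet G ω r ε).ncard ≤ 2 * Fintype.card V := by
  classical
  choose P hP using fun v => (hG.existsUnique_path r v).exists
  let S : Finset ℝ := Finset.univ.biUnion fun v : V =>
    {-Int.fract (wWeight ω (P v)), -Int.fract (wWeight ω (P v)) - 1}
  have hS : Set.MapsTo Prod.fst (errorRangeSet G ω r ε) (S : Set ℝ) := by
    intro E hE
    obtain ⟨v, p, hp, h⟩ := exists_fst_eq_of_mem_errorRangeSet hG.isAcyclic hε2 hE
    have hpP : p = P v := (hG.existsUnique_path r v).unique hp (hP v)
    subst hpP
    simp only [S, Finset.coe_biUnion, Set.mem_iUnion]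
    exact ⟨v, by simp, by simpa using h⟩
  have hinj := injOn_fst_errorRangeSet G ω r ε
  have hcard : S.card ≤ 2 * Fintype.card V := by
    rw [mul_comm]
    exact Finset.card_biUnion_le_card_mul _ _ _ fun v _ => Finset.card_le_two
  refine ⟨Set.Finite.of_injOn hS hinj S.finite_toSet, le_trans ?_ hcard⟩
  rw [← Set.ncard_coe_finset]
  exact Set.ncard_le_ncard_of_injOn _ hS hinj S.finite_toSet
end

section
/- Let T_u be a finite tree with root u and nonnegative real edge weights, let T'_u be T_u together with one additional edge {p(u), u} of weight w ≥ 0, rooted at p(u), and set f = w − ⌊w⌋. Let 0 < ε < 2. Suppose ω̃ is a function assigning natural numbers to the edges of T'_u whose restriction to T_u is an ε-rounding of T_u with root error range [a, b], and which assigns ⌊w⌋ + k to the edge {p(u), u} for some integer k. Then ω̃ is an ε-rounding of T'_u if and only if −ε < a + k − f and b + k − f < ε; and in that case the root error range of T'_u under ω̃ is [min(a + k − f, 0), max(0, b + k − f)]. Moreover, in any ε-rounding of T'_u, the value assigned to {p(u), u} equals ⌊w⌋ + k for some k ∈ {−1, 0, 1, 2}. -/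
open SimpleGraph

/-- The rounding error of a walk. -/
noncomputable def errW {V : Type*} {G : SimpleGraph V} (ω : V → V → ℝ) (wt : V → V → ℕ)
    {u v : V} (p : G.Walk u v) : ℝ :=
  wWeight (fun a b => (wt a b : ℝ)) p - wWeight ω p

section WalkErrors

variable {V : Type*} {G : SimpleGraph V}

theorem errW_nil (ω : V → V → ℝ) (wt : V → V → ℕ) (u : V) :
    errW ω wt (Walk.nil : G.Walk u u) = 0 := by
  simp [errW, wWeight]

theorem errW_cons (ω : V → V → ℝ) (wt : V → V → ℕ) {u v x : V} (h : G.Adj u v)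
    (p : G.Walk v x) :
    errW ω wt (Walk.cons h p) = ((wt u v : ℝ) - ω u v) + errW ω wt p := by
  simp only [errW, wWeight, Walk.darts_cons, List.map_cons, List.sum_cons]
  ring

theorem wWeight_reverse {w : V → V → ℝ} (hw : ∀ a b, w a b = w b a) {u v : V}
    (p : G.Walk u v) : wWeight w p.reverse = wWeight w p := by
  have hcomp : ((fun d : G.Dart => w d.toProd.1 d.toProd.2) ∘ Dart.symm) =
      fun d => w d.toProd.1 d.toProd.2 := by
    ext d
    exact hw _ _
  simp [wWeight, Walk.darts_reverse, List.map_reverse, List.sum_reverse, hcomp]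

theorem errW_reverse {ω : V → V → ℝ} {wt : V → V → ℕ} (hω : ∀ a b, ω a b = ω b a)
    (hwt : ∀ a b, wt a b = wt b a) {u v : V} (p : G.Walk u v) :
    errW ω wt p.reverse = errW ω wt p := by
  rw [errW, errW, wWeight_reverse hω, wWeight_reverse fun a b => by rw [hwt a b]]

/-- A vertex with at most one neighbour can only occur on a path as one of its endpoints. -/
theorem eq_endpoint_of_mem_support_of_leaf {l u : V} (hleaf : ∀ x, G.Adj l x → x = u)
    {v v' : V} (p : G.Walk v v') (hp : p.IsPath) (hl : l ∈ p.support) : v = l ∨ v' = l := by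
  induction p with
  | nil => simp_all
  | @cons v x v' h q ih =>
    rw [Walk.cons_isPath_iff] at hp
    rw [Walk.support_cons, List.mem_cons] at hl
    rcases hl with rfl | hl
    · exact Or.inl rfl
    rcases ih hp.1 hl with rfl | rfl
    · cases q with
      | nil => exact Or.inr rfl
      | cons h' r =>
        refine absurd ?_ hp.2
        rw [hleaf _ h.symm, ← hleaf _ h']
        simp
    · exact Or.inr rfl

/-- The rounding errors of the paths from a leaf are `0` and the shifts, by the error of the leaf
edge, of the errors of the paths from its neighbour that avoid the leaf. -/
theorem exists_isPath_errW_iff_of_leaf {l u : V} (hadj : G.Adj l u)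
    (hleaf : ∀ x, G.Adj l x → x = u) (ω : V → V → ℝ) (wt : V → V → ℕ) (x : ℝ) :
    (∃ (v : V) (p : G.Walk l v), p.IsPath ∧ x = errW ω wt p) ↔
      x = 0 ∨ ∃ y, (∃ (v : V) (p : G.Walk u v), p.IsPath ∧ l ∉ p.support ∧
        y = errW ω wt p) ∧ x = ((wt l u : ℝ) - ω l u) + y := by
  constructor
  · rintro ⟨v, p, hp, rfl⟩
    cases p with
    | nil => exact Or.inl (errW_nil _ _ _)
    | cons h q =>
      obtain rfl := hleaf _ h
      rw [Walk.cons_isPath_iff] at hp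
      exact Or.inr ⟨_, ⟨v, q, hp.1, hp.2, rfl⟩, errW_cons _ _ _ _⟩
  · rintro (rfl | ⟨y, ⟨v, p, hp, hl, rfl⟩, rfl⟩)
    · exact ⟨l, Walk.nil, Walk.IsPath.nil, (errW_nil _ _ _).symm⟩
    · exact ⟨v, Walk.cons hadj p, hp.cons hl, (errW_cons _ _ _ _).symm⟩

theorem finite_setOf_errW_isPath [Finite V] (hG : G.IsAcyclic) (ω : V → V → ℝ)
    (wt : V → V → ℕ) (u : V) :
    {x | ∃ (v : V) (p : G.Walk u v), p.IsPath ∧ x = errW ω wt p}.Finite := by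
  classical
  refine (Set.finite_range fun v : V =>
    if h : ∃ p : G.Walk u v, p.IsPath then errW ω wt h.choose else 0).subset ?_
  rintro x ⟨v, p, hp, rfl⟩
  have h : ∃ p : G.Walk u v, p.IsPath := ⟨p, hp⟩
  refine ⟨v, ?_⟩
  have heq : h.choose = p :=
    congrArg Subtype.val ((hG.subsingleton_path u v).elim ⟨h.choose, h.choose_spec⟩ ⟨p, hp⟩)
  simp only [dif_pos h, heq]

end WalkErrors

/-- **moving up.**
Let `T'ᵤ` be a finite tree (`G`) consisting of a subtree `Tᵤ` rooted at `u` together with one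
extra edge `{pu, u}` of weight `w ≥ 0` to a new leaf `pu` (the new root), and let
`f = w − ⌊w⌋` and `0 < ε < 2`.  Suppose the natural-number weights `wt` restrict to an
`ε`-rounding of `Tᵤ` with root error range `[a, b]`, and `wt` assigns `⌊w⌋ + k` to `{pu, u}`.
Then `wt` is an `ε`-rounding of `T'ᵤ` iff `−ε < a + k − f` and `b + k − f < ε`; in that case
the root error range of `T'ᵤ` is `[min (a + k − f) 0, max 0 (b + k − f)]`.  Moreover any
`ε`-rounding of `T'ᵤ` assigns `⌊w⌋ + k'` to `{pu, u}` for some `k' ∈ {−1, 0, 1, 2}`. -/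
theorem moving_up {V : Type*} [Fintype V] (G : SimpleGraph V) (hG : G.IsTree)
    (ω : V → V → ℝ) (hsym : ∀ a b, ω a b = ω b a) (hnonneg : ∀ a b, 0 ≤ ω a b)
    (pu u : V) (hadj : G.Adj pu u) (hleaf : ∀ x, G.Adj pu x → x = u)
    (f : ℝ) (hf : f = ω pu u - ⌊ω pu u⌋)
    (ε : ℝ) (hε0 : 0 < ε) (hε2 : ε < 2)
    (wt : V → V → ℕ) (hwts : ∀ a b, wt a b = wt b a)
    (hrest : ∀ (v v' : V) (p : G.Walk v v'), p.IsPath → pu ∉ p.support →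
      |errW ω wt p| < ε)
    (a b : ℝ)
    (ha : a = sInf {x | ∃ (v : V) (p : G.Walk u v), p.IsPath ∧ pu ∉ p.support ∧
      x = errW ω wt p})
    (hb : b = sSup {x | ∃ (v : V) (p : G.Walk u v), p.IsPath ∧ pu ∉ p.support ∧
      x = errW ω wt p})
    (k : ℤ) (hk : (wt pu u : ℤ) = ⌊ω pu u⌋ + k) :
    ((∀ (v v' : V) (p : G.Walk v v'), p.IsPath → |errW ω wt p| < ε) ↔
      (-ε < a + k - f ∧ b + k - f < ε)) ∧
    ((-ε < a + k - f ∧ b + k - f < ε) →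
      sInf {x | ∃ (v : V) (p : G.Walk pu v), p.IsPath ∧ x = errW ω wt p} =
        min (a + k - f) 0 ∧
      sSup {x | ∃ (v : V) (p : G.Walk pu v), p.IsPath ∧ x = errW ω wt p} =
        max 0 (b + k - f)) ∧
    (∀ wt' : V → V → ℕ, (∀ a' b', wt' a' b' = wt' b' a') →
      (∀ (v v' : V) (p : G.Walk v v'), p.IsPath → |errW ω wt' p| < ε) →
      ∃ k' : ℤ, (k' = -1 ∨ k' = 0 ∨ k' = 1 ∨ k' = 2) ∧ (wt' pu u : ℤ) = ⌊ω pu u⌋ + k') := by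
  set S : Set ℝ := {x | ∃ (v : V) (p : G.Walk u v), p.IsPath ∧ pu ∉ p.support ∧
    x = errW ω wt p} with hS
  have hfin : S.Finite := (finite_setOf_errW_isPath hG.isAcyclic ω wt u).subset
    fun x ⟨v, p, hp, _, hx⟩ => ⟨v, p, hp, hx⟩
  have hne : S.Nonempty :=
    ⟨0, u, Walk.nil, Walk.IsPath.nil, by simpa using hadj.ne, (errW_nil _ _ _).symm⟩
  have haS : IsLeast S a :=
    ha ▸ ⟨hne.csInf_mem hfin, fun x hx => csInf_le hfin.bddBelow hx⟩
  have hbS : IsGreatest S b :=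
    hb ▸ ⟨hne.csSup_mem hfin, fun x hx => le_csSup hfin.bddAbove hx⟩
  have hroot := exists_isPath_errW_iff_of_leaf hadj hleaf ω wt
  have hc : (wt pu u : ℝ) - ω pu u = k - f := by
    have : (wt pu u : ℝ) = ⌊ω pu u⌋ + k := by exact_mod_cast hk
    rw [this, hf]
    ring
  simp only [hc] at hroot
  refine ⟨⟨fun h => ?_, fun h => ?_⟩, fun _ => ⟨?_, ?_⟩, fun wt' _ h => ?_⟩
  · obtain ⟨v, p, hp, hpa⟩ := (hroot (k - f + a)).2 (Or.inr ⟨a, haS.1, rfl⟩)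
    obtain ⟨v', q, hq, hqb⟩ := (hroot (k - f + b)).2 (Or.inr ⟨b, hbS.1, rfl⟩)
    have h₁ := abs_lt.1 (h _ _ p hp)
    have h₂ := abs_lt.1 (h _ _ q hq)
    constructor <;> linarith
  · have hfrom : ∀ (v : V) (p : G.Walk pu v), p.IsPath → |errW ω wt p| < ε := by
      intro v p hp
      rcases (hroot _).1 ⟨v, p, hp, rfl⟩ with h0 | ⟨y, hy, hpy⟩
      · rwa [h0, abs_zero]
      · have hay := haS.2 hy
        have hyb := hbS.2 hy
        rw [hpy, abs_lt]
        constructor <;> linarith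
    intro v v' p hp
    by_cases hmem : pu ∈ p.support
    · rcases eq_endpoint_of_mem_support_of_leaf hleaf p hp hmem with rfl | rfl
      · exact hfrom _ p hp
      · rw [← errW_reverse hsym hwts]
        exact hfrom _ _ hp.reverse
    · exact hrest v v' p hp hmem
  · refine IsLeast.csInf_eq ⟨(hroot _).2 ?_, fun x hx => ?_⟩
    · rcases min_choice (a + k - f) 0 with h | h <;> rw [h]
      · exact Or.inr ⟨a, haS.1, by ring⟩
      · exact Or.inl rfl
    · rcases (hroot x).1 hx with rfl | ⟨y, hy, rfl⟩
      · exact min_le_right _ _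
      · have hay := haS.2 hy
        exact (min_le_left _ _).trans (by linarith)
  · refine IsGreatest.csSup_eq ⟨(hroot _).2 ?_, fun x hx => ?_⟩
    · rcases max_choice 0 (b + k - f) with h | h <;> rw [h]
      · exact Or.inl rfl
      · exact Or.inr ⟨b, hbS.1, by ring⟩
    · rcases (hroot x).1 hx with rfl | ⟨y, hy, rfl⟩
      · exact le_max_left _ _
      · have hyb := hbS.2 hy
        exact le_trans (by linarith) (le_max_right _ _)
  · have hedge := h _ _ (Walk.cons hadj Walk.nil) (by simpa using hadj.ne)
    rw [errW_cons, errW_nil, add_zero, abs_lt] at hedge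
    have hfl := Int.floor_le (ω pu u)
    have hlt := Int.lt_floor_add_one (ω pu u)
    have h₁ : (-2 : ℤ) < wt' pu u - ⌊ω pu u⌋ := by
      have : (-2 : ℝ) < wt' pu u - ⌊ω pu u⌋ := by linarith
      exact_mod_cast this
    have h₂ : (wt' pu u : ℤ) - ⌊ω pu u⌋ < 3 := by
      have : (wt' pu u : ℝ) - ⌊ω pu u⌋ < 3 := by linarith
      exact_mod_cast this
    exact ⟨wt' pu u - ⌊ω pu u⌋, by omega, by ring⟩
end
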